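/- arXiv:2412.08919 — 3 statements merged into one kernel-verified Lean document; each statement's English description precedes it below -/
import Mathlib

section
/- Let K be a field, s a positive integer, and R = K[x^s, x^{−s}] = ⊕_{i∈sℤ} K xⁱ the ℤ-graded ring of Laurent polynomials in x^s. Let γ₁,…,γₙ, δ₁,…,δₙ ∈ ℤ. If there exist t ∈ ℤ, a permutation π of {1,…,n}, and integers k₁,…,kₙ such that δᵢ = γ_{π(i)} + t + s·kᵢ for all i, then there is a graded ring isomorphism Mₙ(R)(γ₁,…,γₙ) ≅ Mₙ(R)(δ₁,…,δₙ). -/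
open LaurentPolynomial

/-- The `lam`-homogeneous component of the ℤ-graded ring `R = K[x^s, x^{-s}]`.
We model `K[x^s, x^{-s}]` as the Laurent polynomial ring in the variable
`y = x^s`, so that the monomial `y^k = T k` is homogeneous of degree `s·k`;
the degree-`lam` component is `K·x^{lam}` if `s ∣ lam` and `0` otherwise. -/
def lpComponent (K : Type) [Field K] (s : ℕ) (lam : ℤ) : Set (LaurentPolynomial K) :=
  {f | f = 0 ∨ ∃ (k : ℤ) (a : K), lam = (s : ℤ) * k ∧ f = C a * T k}

/-- The `lam`-homogeneous component of the graded matrix ring `Mₙ(R)(γ₁,…,γₙ)`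
over `R = K[x^s, x^{-s}]`: matrices `x` with `xᵢⱼ ∈ R_{lam+γⱼ-γᵢ}` for all `i, j`. -/
def matComponent (K : Type) [Field K] (s : ℕ) {n : ℕ} (γ : Fin n → ℤ) (lam : ℤ) :
    Set (Matrix (Fin n) (Fin n) (LaurentPolynomial K)) :=
  {x | ∀ i j, x i j ∈ lpComponent K s (lam + γ j - γ i)}

/-- The ring automorphism of `Mₙ(K[T;T⁻¹])` given by conjugation by the monomial matrix attached
to the permutation `π` and the exponents `k`. -/
noncomputable def monomialConj (K : Type) [Field K] {n : ℕ} (π : Equiv.Perm (Fin n))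
    (k : Fin n → ℤ) :
    Matrix (Fin n) (Fin n) (LaurentPolynomial K) ≃+*
      Matrix (Fin n) (Fin n) (LaurentPolynomial K) where
  toFun x := Matrix.of fun i j => T (k j - k i) * x (π i) (π j)
  invFun y := Matrix.of fun i j => T (k (π.symm i) - k (π.symm j)) * y (π.symm i) (π.symm j)
  left_inv x := by
    ext1 i j
    simp [← mul_assoc]
  right_inv y := by
    ext1 i j
    simp [← mul_assoc]
  map_add' x y := by
    ext1 i j
    simp [mul_add]
  map_mul' x y := by
    ext1 i j
    simp only [Matrix.of_apply, Matrix.mul_apply, Finset.mul_sum]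
    rw [← Equiv.sum_comp π]
    refine Finset.sum_congr rfl fun l _ => ?_
    rw [mul_mul_mul_comm, ← T_add, sub_add_sub_cancel']

theorem monomialConj_apply (K : Type) [Field K] {n : ℕ} (π : Equiv.Perm (Fin n))
    (k : Fin n → ℤ) (x : Matrix (Fin n) (Fin n) (LaurentPolynomial K)) (i j : Fin n) :
    monomialConj K π k x i j = T (k j - k i) * x (π i) (π j) :=
  rfl

theorem T_mul_mem_lpComponent {K : Type} [Field K] {s : ℕ} {lam : ℤ} {f : LaurentPolynomial K}
    (hf : f ∈ lpComponent K s lam) (m : ℤ) : T m * f ∈ lpComponent K s (lam + s * m) := by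
  rcases hf with rfl | ⟨k, a, rfl, rfl⟩
  · exact Or.inl (mul_zero _)
  · refine Or.inr ⟨k + m, a, by ring, ?_⟩
    rw [T_add]
    ring

theorem T_mul_mem_lpComponent_iff {K : Type} [Field K] {s : ℕ} {lam m : ℤ}
    {f : LaurentPolynomial K} :
    T m * f ∈ lpComponent K s (lam + s * m) ↔ f ∈ lpComponent K s lam := by
  refine ⟨fun hf => ?_, fun hf => T_mul_mem_lpComponent hf m⟩
  simpa [← mul_assoc, ← T_add] using T_mul_mem_lpComponent hf (-m)

/-- Let `R = K[x^s, x^{-s}]` and `γ₁,…,γₙ, δ₁,…,δₙ ∈ ℤ`. If there are `t ∈ ℤ`, a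
permutation `π` of `{1,…,n}` and integers `k₁,…,kₙ` with
`δᵢ = γ_{π(i)} + t + s·kᵢ` for all `i`, then there is a graded ring isomorphism
`Mₙ(R)(γ₁,…,γₙ) ≅ Mₙ(R)(δ₁,…,δₙ)`. -/
theorem graded_matrix_iso_of_shift (K : Type) [Field K] (s : ℕ) (hs : 0 < s)
    (n : ℕ) (γ δ : Fin n → ℤ)
    (h : ∃ (t : ℤ) (π : Equiv.Perm (Fin n)) (k : Fin n → ℤ),
      ∀ i, δ i = γ (π i) + t + (s : ℤ) * k i) :
    ∃ φ : Matrix (Fin n) (Fin n) (LaurentPolynomial K) ≃+*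
        Matrix (Fin n) (Fin n) (LaurentPolynomial K),
      ∀ lam : ℤ, φ '' matComponent K s γ lam = matComponent K s δ lam := by
  obtain ⟨t, π, k, h⟩ := h
  refine ⟨monomialConj K π k, fun lam => ?_⟩
  have key : ∀ x, monomialConj K π k x ∈ matComponent K s δ lam ↔
      x ∈ matComponent K s γ lam := by
    intro x
    have entry : ∀ i j, monomialConj K π k x i j ∈ lpComponent K s (lam + δ j - δ i) ↔
        x (π i) (π j) ∈ lpComponent K s (lam + γ (π j) - γ (π i)) := by
      intro i j
      have hdeg : lam + δ j - δ i = lam + γ (π j) - γ (π i) + s * (k j - k i) := by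
        rw [h i, h j]
        ring
      rw [monomialConj_apply, hdeg, T_mul_mem_lpComponent_iff]
    simp only [matComponent, Set.mem_ofPred_eq, entry]
    exact ⟨fun hx i j => by simpa using hx (π.symm i) (π.symm j), fun hx i j => hx _ _⟩
  ext y
  obtain ⟨x, rfl⟩ := (monomialConj K π k).surjective y
  rw [(monomialConj K π k).injective.mem_set_image, key]
end

section
/- Let K be a field, s a positive integer, and R = K[x^s, x^{−s}] = ⊕_{i∈sℤ} K xⁱ the ℤ-graded ring of Laurent polynomials in x^s. Let γ₁,…,γₙ, δ₁,…,δ_m ∈ ℤ. If there is a graded ring isomorphism Mₙ(R)(γ₁,…,γₙ) ≅ M_m(R)(δ₁,…,δ_m), then n = m and there exist t ∈ ℤ and a permutation π of {1,…,n} such that δᵢ ≡ γ_{π(i)} + t (mod s) for all i. -/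
open LaurentPolynomial

namespace Matrix

theorem rank_add_of_isIdempotentElem {K ι : Type*} [Field K] [Fintype ι] [DecidableEq ι]
    {e f : Matrix ι ι K} (he : IsIdempotentElem e) (hf : IsIdempotentElem f)
    (hef : e * f = 0) (hfe : f * e = 0) : (e + f).rank = e.rank + f.rank := by
  have hsup : LinearMap.range (e + f).mulVecLin
      = LinearMap.range e.mulVecLin ⊔ LinearMap.range f.mulVecLin := by
    apply le_antisymm
    · rw [mulVecLin_add]
      exact LinearMap.range_add_le _ _
    · rw [sup_le_iff]
      constructor
      · rintro _ ⟨v, rfl⟩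
        exact ⟨e *ᵥ v, by simp [he.eq, hfe]⟩
      · rintro _ ⟨v, rfl⟩
        exact ⟨f *ᵥ v, by simp [hf.eq, hef]⟩
  have hinf : LinearMap.range e.mulVecLin ⊓ LinearMap.range f.mulVecLin = ⊥ := by
    rw [eq_bot_iff]
    rintro _ ⟨⟨v, rfl⟩, ⟨w, hw⟩⟩
    have h : e *ᵥ (e *ᵥ v) = e *ᵥ (f *ᵥ w) := congrArg (e *ᵥ ·) hw.symm
    simpa [he.eq, hef] using h
  have h := Submodule.finrank_sup_add_finrank_inf_eq
    (LinearMap.range e.mulVecLin) (LinearMap.range f.mulVecLin)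
  rw [hinf, ← hsup, finrank_bot, add_zero] at h
  exact h

theorem rank_sum_of_orthogonalIdempotents {K ι κ : Type*} [Field K] [Fintype ι] [DecidableEq ι]
    {e : κ → Matrix ι ι K} (he : OrthogonalIdempotents e) (S : Finset κ) :
    (∑ k ∈ S, e k).rank = ∑ k ∈ S, (e k).rank := by
  classical
  induction S using Finset.induction_on with
  | empty => simp
  | insert a S ha ih =>
    rw [Finset.sum_insert ha, Finset.sum_insert ha, ← ih]
    exact rank_add_of_isIdempotentElem (he.idem a) he.isIdempotentElem_sum
      (he.mul_sum_of_notMem ha) (by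
        rw [Finset.sum_mul]
        exact Finset.sum_eq_zero fun k hk ↦ he.ortho fun h ↦ ha (h ▸ hk))

end Matrix

/-- The projection of `K^m` onto the coordinates labelled by `r`. -/
def labelProjection (K : Type) [Field K] {ι R : Type} [DecidableEq ι] [DecidableEq R]
    (c : ι → R) (r : R) : Matrix ι ι K :=
  Matrix.diagonal fun j ↦ if c j = r then 1 else 0

theorem rank_labelProjection (K : Type) [Field K] {ι R : Type} [Fintype ι] [DecidableEq ι]
    [DecidableEq R] (c : ι → R) (r : R) :
    (labelProjection K c r).rank = Fintype.card {j // c j = r} := by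
  classical
  rw [labelProjection, Matrix.rank_diagonal]
  exact Fintype.card_congr (Equiv.subtypeEquivRight fun j ↦ by simp)

/-- The specialization of Laurent polynomials at `T = 1`. -/
noncomputable def specializeOne (K : Type) [Field K] : LaurentPolynomial K →+* K :=
  LaurentPolynomial.eval₂ (RingHom.id K) 1

theorem labelProjection_mul_specializeOne {K : Type} [Field K] {s m : ℕ} {δ : Fin m → ℤ}
    {lam : ℤ} {x : Matrix (Fin m) (Fin m) (LaurentPolynomial K)}
    (hx : x ∈ matComponent K s δ lam) (r : ZMod s) :
    labelProjection K (fun j ↦ (δ j : ZMod s)) (r + lam) * x.map (specializeOne K)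
      = x.map (specializeOne K) * labelProjection K (fun j ↦ (δ j : ZMod s)) r := by
  ext k l
  rw [labelProjection, labelProjection, Matrix.diagonal_mul, Matrix.mul_diagonal]
  obtain h | ⟨q, a, h, -⟩ := hx k l
  · simp [h]
  · have h' : (lam : ZMod s) + δ l - δ k = 0 := by
      have := congrArg (Int.cast : ℤ → ZMod s) h
      simpa using this
    have : (δ k : ZMod s) = r + lam ↔ (δ l : ZMod s) = r := by
      constructor <;> intro h
      · linear_combination h + h'
      · linear_combination h - h'
    simp [this]

theorem single_mem_matComponent (K : Type) [Field K] (s : ℕ) {n : ℕ} (γ : Fin n → ℤ)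
    (i j : Fin n) : Matrix.single i j 1 ∈ matComponent K s γ (γ i - γ j) := by
  intro k l
  by_cases h : i = k ∧ j = l
  · obtain ⟨rfl, rfl⟩ := h
    exact Or.inr ⟨0, 1, by ring, by simp⟩
  · exact Or.inl (Matrix.single_apply_of_ne _ _ _ _ _ h)

/-- A graded homomorphism of matrix rings makes the residue distribution of `δ` a convolution
of that of `γ`. -/
theorem exists_card_residue_eq_sum {K : Type} [Field K] {s n m : ℕ}
    {γ : Fin n → ℤ} {δ : Fin m → ℤ}
    (φ : Matrix (Fin n) (Fin n) (LaurentPolynomial K) →+*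
        Matrix (Fin m) (Fin m) (LaurentPolynomial K))
    (hφ : ∀ lam : ℤ, ∀ x ∈ matComponent K s γ lam, φ x ∈ matComponent K s δ lam) :
    ∃ g : ZMod s → ℕ, ∀ r : ZMod s,
      Fintype.card {j // (δ j : ZMod s) = r} = ∑ i, g (r - γ i) := by
  set P := labelProjection K (fun j ↦ (δ j : ZMod s)) with hP
  set ψ := ((specializeOne K).mapMatrix (m := Fin m)).comp φ with hψ
  set u : Fin n → Fin n → Matrix (Fin m) (Fin m) K := fun i j ↦ ψ (Matrix.single i j 1) with hu
  have hcomm (i j : Fin n) (r : ZMod s) : P (r + (γ i - γ j)) * u i j = u i j * P r := by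
    have := labelProjection_mul_specializeOne (hφ _ _ (single_mem_matComponent K s γ i j)) r
    rwa [Int.cast_sub] at this
  have hmul (i j k : Fin n) : u i j * u j k = u i k := by
    simp [hu, ← map_mul]
  have hzero (i j : Fin n) (hij : i ≠ j) : u i i * u j j = 0 := by
    simp [hu, ← map_mul, hij]
  have hone : ∑ i, u i i = 1 := by
    simp only [hu, ← map_sum, Matrix.sum_single_one, map_one]
  have hidem (r : ZMod s) : P r * P r = P r := by
    simp [hP, labelProjection]
  have hPu (i : Fin n) (r : ZMod s) : P r * u i i = u i i * P r := by
    simpa using hcomm i i r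
  have hle (i j : Fin n) (r : ZMod s) :
      (P (r + γ i) * u i i).rank ≤ (P (r + γ j) * u j j).rank := by
    have : P (r + γ i) * u i i = u i j * (P (r + γ j) * u j j) * u j i := by
      have h := hcomm i j (r + γ j)
      rw [show r + (γ j : ZMod s) + (γ i - γ j) = r + γ i by ring] at h
      rw [mul_assoc, mul_assoc, hmul, ← mul_assoc, ← h, mul_assoc, hmul]
    rw [this]
    exact (Matrix.rank_mul_le_left _ _).trans (Matrix.rank_mul_le_right _ _)
  have hsum (r : ZMod s) :
      Fintype.card {j // (δ j : ZMod s) = r} = ∑ i, (P r * u i i).rank := by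
    have he : OrthogonalIdempotents fun i ↦ P r * u i i := by
      refine ⟨fun i ↦ ?_, fun i j hij ↦ ?_⟩
      · change P r * u i i * (P r * u i i) = P r * u i i
        rw [mul_assoc, ← mul_assoc (u i i), ← hPu, mul_assoc, hmul, ← mul_assoc, hidem]
      · change P r * u i i * (P r * u j j) = 0
        rw [mul_assoc, ← mul_assoc (u i i), ← hPu, mul_assoc, hzero i j hij, mul_zero, mul_zero]
    rw [← Matrix.rank_sum_of_orthogonalIdempotents he, ← Finset.mul_sum, hone, mul_one, hP,
      rank_labelProjection]
  rcases isEmpty_or_nonempty (Fin n) with hn | ⟨⟨i₀⟩⟩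
  · exact ⟨0, fun r ↦ by rw [hsum]; simp⟩
  · refine ⟨fun r ↦ (P (r + γ i₀) * u i₀ i₀).rank, fun r ↦ ?_⟩
    rw [hsum]
    refine Finset.sum_congr rfl fun i _ ↦ ?_
    have h : (P (r - γ i + γ i) * u i i).rank = (P (r - γ i + γ i₀) * u i₀ i₀).rank :=
      le_antisymm (hle i i₀ _) (hle i₀ i _)
    rwa [sub_add_cancel] at h

theorem eq_card_mul_sum_of_card_fiber_eq {R : Type} [AddGroup R] [Fintype R] [DecidableEq R]
    {n m : ℕ} {c : Fin n → R} {d : Fin m → R} {g : R → ℕ}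
    (h : ∀ r, Fintype.card {j // d j = r} = ∑ i, g (r - c i)) : m = n * ∑ r, g r := by
  calc m = Fintype.card (Σ r, {j // d j = r}) := by
        rw [Fintype.card_congr (Equiv.sigmaFiberEquiv d), Fintype.card_fin]
    _ = ∑ i, ∑ r, g (r - c i) := by
        rw [Fintype.card_sigma, Finset.sum_comm]
        exact Finset.sum_congr rfl fun r _ ↦ h r
    _ = ∑ _i : Fin n, ∑ r, g r :=
        Finset.sum_congr rfl fun i _ ↦ Equiv.sum_comp (Equiv.subRight (c i)) g
    _ = n * ∑ r, g r := by simp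

/-- Let `R = K[x^s, x^{-s}]`, `γ₁,…,γₙ, δ₁,…,δ_m ∈ ℤ`. If there is a graded ring
isomorphism `Mₙ(R)(γ₁,…,γₙ) ≅ M_m(R)(δ₁,…,δ_m)` (a ring isomorphism mapping each
`λ`-homogeneous component onto the corresponding one), then `n = m` and there are
`t ∈ ℤ` and a permutation `π` of `{1,…,n}` with `δᵢ ≡ γ_{π(i)} + t (mod s)` for
all `i`. -/
theorem graded_matrix_iso_laurent_classification (K : Type) [Field K] (s : ℕ) (hs : 0 < s)
    (n m : ℕ) (γ : Fin n → ℤ) (δ : Fin m → ℤ)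
    (φ : Matrix (Fin n) (Fin n) (LaurentPolynomial K) ≃+*
        Matrix (Fin m) (Fin m) (LaurentPolynomial K))
    (hφ : ∀ lam : ℤ, φ '' matComponent K s γ lam = matComponent K s δ lam) :
    n = m ∧ ∃ (t : ℤ) (π : Fin m → Fin n), Function.Bijective π ∧
      ∀ i, (s : ℤ) ∣ (δ i - (γ (π i) + t)) := by
  have : NeZero s := ⟨hs.ne'⟩
  have hφ' (lam : ℤ) (x) (hx : x ∈ matComponent K s γ lam) : φ x ∈ matComponent K s δ lam :=
    hφ lam ▸ Set.mem_image_of_mem φ hx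
  have hψ' (lam : ℤ) (x) (hx : x ∈ matComponent K s δ lam) :
      φ.symm x ∈ matComponent K s γ lam := by
    rw [← hφ lam] at hx
    obtain ⟨y, hy, rfl⟩ := hx
    simpa using hy
  obtain ⟨g, hg⟩ := exists_card_residue_eq_sum φ.toRingHom hφ'
  obtain ⟨g', hg'⟩ := exists_card_residue_eq_sum φ.symm.toRingHom hψ'
  have hm := eq_card_mul_sum_of_card_fiber_eq hg
  have hn := eq_card_mul_sum_of_card_fiber_eq hg'
  obtain rfl : n = m := Nat.dvd_antisymm ⟨_, hm⟩ ⟨_, hn⟩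
  refine ⟨rfl, ?_⟩
  rcases Nat.eq_zero_or_pos n with rfl | hpos
  · exact ⟨0, id, Function.bijective_id, fun i ↦ i.elim0⟩
  have hg1 : ∑ r, g r = 1 := Nat.eq_of_mul_eq_mul_left hpos (by rw [← hm, mul_one])
  obtain ⟨t, ht⟩ : ∃ t, g = Pi.single t 1 := by
    obtain ⟨t, -, ht⟩ : ∃ t ∈ Finset.univ, g t ≠ 0 :=
      Finset.exists_ne_zero_of_sum_ne_zero (by rw [hg1]; exact one_ne_zero)
    rw [← Finset.add_sum_erase _ _ (Finset.mem_univ t)] at hg1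
    have h0 : ∑ r ∈ Finset.univ.erase t, g r = 0 := by omega
    refine ⟨t, funext fun r ↦ ?_⟩
    by_cases hr : r = t
    · subst hr
      rw [Pi.single_eq_same]
      omega
    · rw [Pi.single_eq_of_ne hr]
      exact Finset.sum_eq_zero_iff.1 h0 r (by simp [hr])
  have hcard (r : ZMod s) : Fintype.card {i // (δ i : ZMod s) = r}
      = Fintype.card {i // (γ i : ZMod s) + t = r} := by
    rw [hg, ht, Fintype.card_subtype, Finset.card_filter]
    refine Finset.sum_congr rfl fun i _ ↦ ?_
    rw [Pi.single_apply]
    exact if_congr (by rw [sub_eq_iff_eq_add, eq_comm, add_comm]) rfl rfl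
  let π := Equiv.ofFiberEquiv (f := fun i ↦ (δ i : ZMod s)) (g := fun i ↦ (γ i : ZMod s) + t)
    fun r ↦ Fintype.equivOfCardEq (hcard r)
  refine ⟨t.val, π, π.bijective, fun i ↦ ?_⟩
  have h : (γ (π i) : ZMod s) + t = δ i :=
    Equiv.ofFiberEquiv_map (g := fun i ↦ (γ i : ZMod s) + t) _ i
  rw [← ZMod.intCast_zmod_eq_zero_iff_dvd]
  simp [← h]
end

section
/- Let K be a field, regarded as a ℤ-graded ring concentrated in degree 0 (K₀ = K and Kₙ = 0 for n ≠ 0). Let γ₁,…,γₙ, δ₁,…,δ_m ∈ ℤ. If there is a graded ring isomorphism Mₙ(K)(γ₁,…,γₙ) ≅ M_m(K)(δ₁,…,δ_m), then n = m and there exist t ∈ ℤ and a permutation π of {1,…,n} such that δᵢ = γ_{π(i)} + t for all i. -/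
/-- The `lam`-homogeneous component of a field `K` regarded as a ℤ-graded ring
concentrated in degree `0`: all of `K` if `lam = 0`, and `{0}` otherwise. -/
def fieldComponent (K : Type) [Field K] (lam : ℤ) : Set K :=
  {a | lam = 0 ∨ a = 0}

/-- The `lam`-homogeneous component of the graded matrix ring `Mₙ(K)(γ₁,…,γₙ)`:
matrices `x` with `xᵢⱼ ∈ K_{lam+γⱼ-γᵢ}` for all `i, j`. -/
def matFieldComponent (K : Type) [Field K] {n : ℕ} (γ : Fin n → ℤ) (lam : ℤ) :
    Set (Matrix (Fin n) (Fin n) K) :=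
  {x | ∀ i j, x i j ∈ fieldComponent K (lam + γ j - γ i)}

/-- If column `k` of the image of the matrix unit `E₀₀` is nonzero, the `k`-th columns of the images
of the matrix units `Eᵢ₀` are linearly independent. -/
theorem linearIndependent_col_map_single {K ι κ : Type*} [Field K] [Fintype ι] [DecidableEq ι]
    [Fintype κ] [DecidableEq κ] (φ : Matrix ι ι K →+* Matrix κ κ K) (i₀ : ι) (k : κ)
    (hk : (φ (Matrix.single i₀ i₀ 1)).col k ≠ 0) :
    LinearIndependent K fun i => (φ (Matrix.single i i₀ 1)).col k := by
  have key (i j : ι) : (φ (Matrix.single i₀ j 1)).mulVec ((φ (Matrix.single i i₀ 1)).col k) =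
      if i = j then (φ (Matrix.single i₀ i₀ 1)).col k else 0 := by
    rw [← Matrix.mulVec_single_one, Matrix.mulVec_mulVec, ← map_mul]
    split_ifs with h
    · subst h
      simp
    · rw [Matrix.single_mul_single_of_ne _ _ _ _ (Ne.symm h)]
      simp only [map_zero, Matrix.zero_mulVec]
  rw [Fintype.linearIndependent_iff]
  intro c hc j
  have h := congrArg (φ (Matrix.single i₀ j 1)).mulVec hc
  simp only [Matrix.mulVec_sum, Matrix.mulVec_smul, key, Matrix.mulVec_zero, smul_ite, smul_zero,
    Finset.sum_ite_eq', Finset.mem_univ, if_true] at h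
  exact (smul_eq_zero.mp h).resolve_right hk

/-- The image of a matrix unit under an injective ring homomorphism has a nonzero column. -/
theorem exists_col_map_single_ne_zero {K ι κ : Type*} [Field K] [Fintype ι] [DecidableEq ι]
    [Fintype κ] [DecidableEq κ] (φ : Matrix ι ι K →+* Matrix κ κ K)
    (hφ : Function.Injective φ) (i₀ : ι) :
    ∃ k, (φ (Matrix.single i₀ i₀ 1)).col k ≠ 0 := by
  by_contra! h
  have h0 : φ (Matrix.single i₀ i₀ 1) = 0 := by
    ext a b
    exact congrFun (h b) a
  have h1 := congrFun (congrFun (hφ (h0.trans (map_zero φ).symm)) i₀) i₀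
  simp at h1

/-- An injective ring homomorphism between matrix rings over a field does not decrease the size. -/
theorem card_le_card_of_matrix_ringHom {K ι κ : Type*} [Field K] [Fintype ι] [DecidableEq ι]
    [Fintype κ] [DecidableEq κ] (φ : Matrix ι ι K →+* Matrix κ κ K)
    (hφ : Function.Injective φ) : Fintype.card ι ≤ Fintype.card κ := by
  rcases isEmpty_or_nonempty ι with _ | ⟨⟨i₀⟩⟩
  · simp
  · obtain ⟨k, hk⟩ := exists_col_map_single_ne_zero φ hφ i₀
    simpa using (linearIndependent_col_map_single φ i₀ k hk).fintype_card_le_finrank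

/-- A square matrix with linearly independent rows has a generalized diagonal without zeros. -/
theorem exists_perm_forall_ne_zero_of_linearIndependent {K ι : Type*} [Field K] [Fintype ι]
    [DecidableEq ι] (A : Matrix ι ι K) (hA : LinearIndependent K A.row) :
    ∃ σ : Equiv.Perm ι, ∀ i, A (σ i) i ≠ 0 := by
  have hdet : A.det ≠ 0 :=
    ((Matrix.isUnit_iff_isUnit_det A).mp (Matrix.linearIndependent_rows_iff_isUnit.mp hA)).ne_zero
  rw [Matrix.det_apply'] at hdet
  obtain ⟨σ, -, hσ⟩ := Finset.exists_ne_zero_of_sum_ne_zero hdet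
  refine ⟨σ, fun i hi => hσ ?_⟩
  exact mul_eq_zero_of_right _ (Finset.prod_eq_zero (Finset.mem_univ i) hi)

/-- The matrix unit `Eᵢⱼ` is homogeneous of degree `γᵢ - γⱼ`. -/
theorem single_mem_matFieldComponent (K : Type) [Field K] {n : ℕ} (γ : Fin n → ℤ) (i j : Fin n) :
    Matrix.single i j (1 : K) ∈ matFieldComponent K γ (γ i - γ j) := by
  intro a b
  by_cases h : i = a ∧ j = b
  · obtain ⟨rfl, rfl⟩ := h
    left
    ring
  · exact Or.inr (Matrix.single_apply_of_ne _ _ _ _ _ h)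

/-- Let `K` be a field regarded as a ℤ-graded ring concentrated in degree `0`, and
`γ₁,…,γₙ, δ₁,…,δ_m ∈ ℤ`. If there is a graded ring isomorphism
`Mₙ(K)(γ₁,…,γₙ) ≅ M_m(K)(δ₁,…,δ_m)` (a ring isomorphism mapping each
`λ`-homogeneous component onto the corresponding one), then `n = m` and there are
`t ∈ ℤ` and a permutation `π` of `{1,…,n}` with `δᵢ = γ_{π(i)} + t` for all `i`. -/
theorem graded_matrix_iso_field_classification (K : Type) [Field K]
    (n m : ℕ) (γ : Fin n → ℤ) (δ : Fin m → ℤ)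
    (φ : Matrix (Fin n) (Fin n) K ≃+* Matrix (Fin m) (Fin m) K)
    (hφ : ∀ lam : ℤ, φ '' matFieldComponent K γ lam = matFieldComponent K δ lam) :
    n = m ∧ ∃ (t : ℤ) (π : Fin m → Fin n), Function.Bijective π ∧
      ∀ i, δ i = γ (π i) + t := by
  obtain rfl : n = m := le_antisymm
    (by simpa using card_le_card_of_matrix_ringHom φ.toRingHom φ.injective)
    (by simpa using card_le_card_of_matrix_ringHom φ.symm.toRingHom φ.symm.injective)
  refine ⟨rfl, ?_⟩
  rcases isEmpty_or_nonempty (Fin n) with _ | ⟨⟨i₀⟩⟩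
  · exact ⟨0, id, Function.bijective_id, isEmptyElim⟩
  obtain ⟨k, hk⟩ := exists_col_map_single_ne_zero φ.toRingHom φ.injective i₀
  obtain ⟨σ, hσ⟩ := exists_perm_forall_ne_zero_of_linearIndependent
    (Matrix.of fun i => (φ (Matrix.single i i₀ 1)).col k)
    (linearIndependent_col_map_single φ.toRingHom i₀ k hk)
  refine ⟨δ k - γ i₀, σ, σ.bijective, fun i => ?_⟩
  have hmem : φ (Matrix.single (σ i) i₀ 1) ∈ matFieldComponent K δ (γ (σ i) - γ i₀) :=
    hφ _ ▸ Set.mem_image_of_mem φ (single_mem_matFieldComponent K γ (σ i) i₀)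
  have hdeg := (hmem i k).resolve_right (hσ i)
  linarith
end
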